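/- Let k ≥ 1 and let n = q·k with q ≥ 3 (i.e., k divides n and n/k > 2). Assume the following hypothesis (Conjecture 1): every ℝ-linear map Ψ on the space of 2k×2k complex Hermitian matrices that maps the set of rank-k Hermitian projections in dimension 2k surjectively onto itself is either of Wigner form or of the form Ψ' ∘ R_k, where Ψ' is of Wigner form and R_k(X) = (1/k)(tr X)·I − X. Then every ℝ-linear map Φ : B_H → B_H (on n×n Hermitian matrices) that maps the set P_k of rank-k Hermitian projections surjectively onto itself is of Wigner form. -/

import Mathlib

open Matrix

set_option synthInstance.maxHeartbeats 1000000
set_option maxHeartbeats 1000000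

noncomputable section

/-- `BH n` is the real vector space of `n × n` complex Hermitian (self-adjoint) matrices. -/
abbrev BH (n : ℕ) := selfAdjoint (Matrix (Fin n) (Fin n) ℂ)

/-- `projSet n k` is the set of rank-`k` Hermitian projections, viewed inside `BH n`. -/
def projSet (n k : ℕ) : Set (BH n) :=
  {P | (P : Matrix (Fin n) (Fin n) ℂ) * (P : Matrix (Fin n) (Fin n) ℂ) = (P : Matrix (Fin n) (Fin n) ℂ)
    ∧ (P : Matrix (Fin n) (Fin n) ℂ).rank = k}

/-- A map is of Wigner form if it is `X ↦ U X U†` or `X ↦ U Xᵀ U†` for some unitary `U`. -/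
def WignerForm (n : ℕ) (Φ : BH n →ₗ[ℝ] BH n) : Prop :=
  ∃ U ∈ Matrix.unitaryGroup (Fin n) ℂ,
    (∀ X : BH n, (Φ X : Matrix (Fin n) (Fin n) ℂ) = U * (X : Matrix (Fin n) (Fin n) ℂ) * Uᴴ) ∨
    (∀ X : BH n, (Φ X : Matrix (Fin n) (Fin n) ℂ) = U * (X : Matrix (Fin n) (Fin n) ℂ)ᵀ * Uᴴ)

/-- The map `R_k(X) = (1/k)(tr X)·I − X` as an `ℝ`-linear endomorphism of `BH n`. -/
def Rmap (n k : ℕ) : BH n →ₗ[ℝ] BH n where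
  toFun X := ⟨(k : ℂ)⁻¹ • (X : Matrix (Fin n) (Fin n) ℂ).trace • (1 : Matrix (Fin n) (Fin n) ℂ)
      - (X : Matrix (Fin n) (Fin n) ℂ), by
    have hX : star ((X : Matrix (Fin n) (Fin n) ℂ)) = (X : Matrix (Fin n) (Fin n) ℂ) := X.2
    have htr : star ((X : Matrix (Fin n) (Fin n) ℂ).trace) = (X : Matrix (Fin n) (Fin n) ℂ).trace := by
      rw [← Matrix.trace_conjTranspose]
      show ((X : Matrix (Fin n) (Fin n) ℂ)ᴴ).trace = _
      rw [show (X : Matrix (Fin n) (Fin n) ℂ)ᴴ = (X : Matrix (Fin n) (Fin n) ℂ) from hX]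
    refine selfAdjoint.mem_iff.mpr ?_
    rw [star_sub, star_smul, star_smul, star_one, htr, hX, star_inv₀]
    norm_num⟩
  map_add' X Y := Subtype.ext (by
    push_cast
    simp only [Matrix.trace_add]
    module)
  map_smul' r X := Subtype.ext (by
    push_cast
    simp only [Matrix.trace_smul, Complex.real_smul, Complex.coe_algebraMap]
    match_scalars <;> simp [Complex.coe_algebraMap] <;> ring)

/-! ### Jordan maps on matrices -/

abbrev CM (n : ℕ) := Matrix (Fin n) (Fin n) ℂ

lemma prime_aux {n : ℕ} (A B : CM n) (h : ∀ Y : CM n, A * Y * B + B * Y * A = 0) :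
    A = 0 ∨ B = 0 := by
  have key : ∀ i j k l, A i j * B k l + B i j * A k l = 0 := by
    intro i j k l
    have := congrFun (congrFun (h (Matrix.single j k 1)) i) l
    simpa [Matrix.mul_apply, Matrix.single_apply, Finset.sum_ite_eq, ite_and] using this
  by_cases hA : A = 0
  · exact Or.inl hA
  right
  obtain ⟨i, j, hij⟩ : ∃ i j, A i j ≠ 0 := by
    by_contra hcon
    push Not at hcon
    exact hA (by ext i j; exact hcon i j)
  have hB : B i j = 0 := by
    have := key i j i j
    have h2 : 2 * (A i j * B i j) = 0 := by linear_combination this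
    simpa [hij] using h2
  ext k l
  have := key i j k l
  rw [hB] at this
  simpa [hij] using this

lemma jordan_aux {n : ℕ} (f : CM n →ₗ[ℂ] CM n) (hs : Function.Surjective f)
    (hJ : ∀ A, f (A * A) = f A * f A) :
    (∀ A B, f (A * B) = f A * f B) ∨ (∀ A B, f (A * B) = f B * f A) := by
  have h1 : ∀ A B, f (A * B) + f (B * A) = f A * f B + f B * f A := by
    intro A B
    have := hJ (A + B)
    have e : (A + B) * (A + B) = A * A + B * B + (A * B + B * A) := by noncomm_ring
    have e' : (f A + f B) * (f A + f B) = f A * f A + f B * f B + (f A * f B + f B * f A) := by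
      noncomm_ring
    rw [e, map_add, map_add, map_add, map_add, hJ, hJ, e'] at this
    exact add_left_cancel this
  have h2 : ∀ A B, f (A * B * A) = f A * f B * f A := by
    intro A B
    have e1 := h1 A (A * B + B * A)
    have e2 := h1 (A * A) B
    rw [hJ] at e2
    rw [map_add f (A * B), h1 A B] at e1
    have e3 : f (A * (A * B + B * A)) + f ((A * B + B * A) * A)
        = f (A * A * B) + f (B * (A * A)) + (2 : ℂ) • f (A * B * A) := by
      rw [← map_smul, ← map_add, ← map_add, ← map_add]
      congr 1
      rw [two_smul]
      noncomm_ring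
    rw [e3, e2] at e1
    have e4 : (2 : ℂ) • f (A * B * A) = (2 : ℂ) • (f A * f B * f A) := by
      have : (2 : ℂ) • (f A * f B * f A) = f A * (f A * f B + f B * f A) + (f A * f B + f B * f A) * f A
        - (f A * f A * f B + f B * (f A * f A)) := by
        rw [two_smul]; noncomm_ring
      rw [this, ← e1]; abel
    exact smul_right_injective _ (two_ne_zero) e4
  have h3 : ∀ A B C, f (A * B * C) + f (C * B * A) = f A * f B * f C + f C * f B * f A := by
    intro A B C
    have := h2 (A + C) B
    have e : (A + C) * B * (A + C) = A * B * A + C * B * C + (A * B * C + C * B * A) := by noncomm_ring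
    rw [e, map_add, map_add, map_add, h2, h2, map_add] at this
    have e' : (f A + f C) * f B * (f A + f C) = f A * f B * f A + f C * f B * f C
      + (f A * f B * f C + f C * f B * f A) := by noncomm_ring
    rw [e'] at this
    exact add_left_cancel this
  have h4 : ∀ A B, f (A * B) = f A * f B ∨ f (A * B) = f B * f A := by
    intro A B
    have := prime_aux (f (A * B) - f A * f B) (f (A * B) - f B * f A) (by
      intro Y
      obtain ⟨X, rfl⟩ := hs Y
      have e1 := h3 (A * B) X (B * A)
      have e2 : f (A * B * X * (B * A)) + f (B * A * X * (A * B))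
          = f (A * (B * X * B) * A) + f (B * (A * X * A) * B) := by
        congr 2 <;> noncomm_ring
      rw [e2, h2, h2, h2, h2] at e1
      have e3 : f (B * A) = f A * f B + f B * f A - f (A * B) := by rw [← h1]; abel
      rw [e3] at e1
      generalize f (A * B) = s at *
      have : (s - f A * f B) * f X * (s - f B * f A) + (s - f B * f A) * f X * (s - f A * f B)
        = (f A * (f B * f X * f B) * f A + f B * (f A * f X * f A) * f B) -
         (s * f X * (f A * f B + f B * f A - s) + (f A * f B + f B * f A - s) * f X * s) := by
        noncomm_ring
      rw [this, e1, sub_self])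
    rcases this with h | h
    · exact Or.inl (sub_eq_zero.1 h)
    · exact Or.inr (sub_eq_zero.1 h)
  have h5 : ∀ A, (∀ B, f (A * B) = f A * f B) ∨ (∀ B, f (A * B) = f B * f A) := by
    intro A
    by_contra hcon
    push Not at hcon
    obtain ⟨⟨B, hB⟩, ⟨C, hC⟩⟩ := hcon
    have hB' := (h4 A B).resolve_left hB
    have hC' := (h4 A C).resolve_right hC
    rcases h4 A (B + C) with h | h
    · simp only [mul_add, map_add, hC', add_left_inj] at h
      exact hB h
    · simp only [mul_add, add_mul, map_add, hB', add_right_inj] at h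
      exact hC h
  by_contra hcon
  push Not at hcon
  obtain ⟨⟨A, B, hA⟩, ⟨C, D, hC⟩⟩ := hcon
  have hA' := (h5 A).resolve_left (fun h => hA (h B))
  have hC' := (h5 C).resolve_right (fun h => hC (h D))
  rcases h5 (A + C) with h | h
  · have := h B
    simp only [add_mul, map_add, hC', add_left_inj] at this
    exact hA this
  · have := h D
    simp only [add_mul, mul_add, map_add, hA', add_right_inj] at this
    exact hC this

lemma star_hom_aux {n : ℕ} (f : CM n →ₗ[ℂ] CM n) (hb : Function.Bijective f)
    (hm : ∀ A B, f (A * B) = f A * f B) (hst : ∀ A, f Aᴴ = (f A)ᴴ) :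
    ∃ U ∈ Matrix.unitaryGroup (Fin n) ℂ, ∀ A, f A = U * A * Uᴴ := by
  let e : CM n ≃⋆ₐ[ℂ] CM n :=
    { LinearEquiv.ofBijective f hb with
      map_mul' := hm
      map_star' := hst }
  let T := Matrix.toEuclideanCLM (n := Fin n) (𝕜 := ℂ)
  let g := (T.symm.trans e).trans T
  obtain ⟨U, hU⟩ := StarAlgEquiv.eq_linearIsometryEquivConjStarAlgEquiv g
    (LinearMap.continuous_of_finiteDimensional (g.toAlgEquiv.toLinearMap))
  let u := (Unitary.linearIsometryEquiv (𝕜 := ℂ) (H := EuclideanSpace ℂ (Fin n))).symm U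
  have hu : Unitary.conjStarAlgAut ℂ _ u = g := by
    rw [hU]
    exact Unitary.conjStarAlgAut_symm_unitaryLinearIsometryEquiv U
  refine ⟨T.symm u, ?_, ?_⟩
  · rw [Matrix.mem_unitaryGroup_iff]
    rw [← map_star, ← map_mul, ← Unitary.coe_star, Unitary.coe_mul_star_self, map_one]
  · intro A
    have h1 : g (T A) = T (f A) := by
      simp only [g, StarAlgEquiv.trans_apply, StarAlgEquiv.symm_apply_apply]
      rfl
    apply (EquivLike.injective T)
    rw [← h1, ← hu, Unitary.conjStarAlgAut_apply, map_mul, map_mul, ← Matrix.star_eq_conjTranspose,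
      map_star]
    simp

lemma wigner_aux {n : ℕ} (f : CM n →ₗ[ℂ] CM n) (hb : Function.Bijective f)
    (hJ : ∀ A, f (A * A) = f A * f A) (hst : ∀ A, f Aᴴ = (f A)ᴴ) :
    ∃ U ∈ Matrix.unitaryGroup (Fin n) ℂ, (∀ A, f A = U * A * Uᴴ) ∨ (∀ A, f A = U * Aᵀ * Uᴴ) := by
  rcases jordan_aux f hb.2 hJ with h | h
  · obtain ⟨U, hU, h⟩ := star_hom_aux f hb h hst
    exact ⟨U, hU, Or.inl h⟩
  · let t : CM n ≃ₗ[ℂ] CM n := Matrix.transposeLinearEquiv (Fin n) (Fin n) ℂ ℂ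
    have ht : ∀ A, t A = Aᵀ := fun _ => rfl
    obtain ⟨U, hU, h⟩ := star_hom_aux (f ∘ₗ t.toLinearMap) (hb.comp t.bijective)
      (fun A B => by simp [ht, h]) (fun A => by
        simp only [LinearMap.comp_apply, LinearEquiv.coe_coe, ht]
        rw [← hst]
        rfl)
    refine ⟨U, hU, Or.inr fun A => ?_⟩
    rw [← h]
    simp [ht]

/-! ### Structure of Hermitian projections -/

/-- Hermitian projection of trace `r`. -/
def HP {n : ℕ} (r : ℕ) (P : CM n) : Prop := Pᴴ = P ∧ P * P = P ∧ P.trace = r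

/-- The projection onto the span of the columns of `U` indexed by `S`. -/
def dg {n : ℕ} (U : CM n) (S : Finset (Fin n)) : CM n :=
  U * diagonal (fun i => if i ∈ S then (1 : ℂ) else 0) * Uᴴ

lemma spec_aux {n : ℕ} (X : CM n) (hX : Xᴴ = X) :
    ∃ U : CM n, Uᴴ * U = 1 ∧ U * Uᴴ = 1 ∧ ∃ d : Fin n → ℝ, X = U * diagonal (fun i => (d i : ℂ)) * Uᴴ := by
  have hX' : X.IsHermitian := hX
  refine ⟨hX'.eigenvectorUnitary, ?_, ?_, hX'.eigenvalues, ?_⟩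
  · exact Matrix.mem_unitaryGroup_iff'.1 hX'.eigenvectorUnitary.2
  · exact Matrix.mem_unitaryGroup_iff.1 hX'.eigenvectorUnitary.2
  · exact hX'.spectral_theorem

lemma rank_trace {n : ℕ} (P : CM n) (hP : P * P = P) : P.trace = P.rank := by
  have hi : IsIdempotentElem (Matrix.toLin' P) := by
    unfold IsIdempotentElem
    rw [Module.End.mul_eq_comp, ← Matrix.toLin'_mul, hP]
  have := (LinearMap.IsIdempotentElem.isProj_range _ hi).trace
  rw [Matrix.trace_toLin'_eq] at this
  exact this

lemma sandwich {n r : ℕ} (V : Matrix (Fin n) (Fin r) ℂ) (hV : Vᴴ * V = 1) (X Y : CM r) :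
    (V * X * Vᴴ) * (V * Y * Vᴴ) = V * (X * Y) * Vᴴ := by
  calc (V * X * Vᴴ) * (V * Y * Vᴴ) = V * X * (Vᴴ * V) * Y * Vᴴ := by simp only [Matrix.mul_assoc]
    _ = _ := by rw [hV]; simp only [Matrix.mul_one, Matrix.mul_assoc]

lemma sandwich_trace {n r : ℕ} (V : Matrix (Fin n) (Fin r) ℂ) (hV : Vᴴ * V = 1) (X : CM r) :
    (V * X * Vᴴ).trace = X.trace := by
  rw [Matrix.trace_mul_comm, ← Matrix.mul_assoc, hV, Matrix.one_mul]

lemma sandwich_star {n r : ℕ} (V : Matrix (Fin n) (Fin r) ℂ) (X : CM r) :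
    (V * X * Vᴴ)ᴴ = V * Xᴴ * Vᴴ := by
  simp [Matrix.conjTranspose_mul, Matrix.mul_assoc]

lemma HP.sandwich {n r k : ℕ} {V : Matrix (Fin n) (Fin r) ℂ} (hV : Vᴴ * V = 1) {P : CM r}
    (hP : HP k P) : HP k (V * P * Vᴴ) := by
  obtain ⟨h1, h2, h3⟩ := hP
  refine ⟨?_, ?_, ?_⟩
  · rw [sandwich_star, h1]
  · rw [_root_.sandwich V hV, h2]
  · rw [sandwich_trace V hV, h3]

lemma HP_diag {n : ℕ} (S : Finset (Fin n)) :
    HP S.card (diagonal (fun i => if i ∈ S then (1 : ℂ) else 0)) := by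
  refine ⟨?_, ?_, ?_⟩
  · rw [Matrix.diagonal_conjTranspose]
    congr 1
    ext i
    simp [apply_ite star]
  · rw [Matrix.diagonal_mul_diagonal]
    congr 1
    ext i
    simp
  · simp [Matrix.trace_diagonal]

lemma HP_dg {n : ℕ} {U : CM n} (hU : Uᴴ * U = 1) (S : Finset (Fin n)) : HP S.card (dg U S) :=
  (HP_diag S).sandwich hU

lemma dg_union {n : ℕ} (U : CM n) {S T : Finset (Fin n)} (h : Disjoint S T) :
    dg U (S ∪ T) = dg U S + dg U T := by
  unfold dg
  rw [← Matrix.add_mul, ← Matrix.mul_add, Matrix.diagonal_add]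
  congr 3
  ext i
  have : i ∈ S → i ∉ T := fun h1 h2 => Finset.disjoint_left.1 h h1 h2
  by_cases h1 : i ∈ S
  · simp [h1, this h1]
  · simp [h1]

lemma dg_univ {n : ℕ} {U : CM n} (hU : U * Uᴴ = 1) : dg U Finset.univ = 1 := by
  simp [dg, hU]

lemma dg_inj {n : ℕ} {U : CM n} (hU : Uᴴ * U = 1) {S T : Finset (Fin n)} (h : dg U S = dg U T) :
    S = T := by
  have key : ∀ S, Uᴴ * dg U S * U = diagonal (fun i => if i ∈ S then (1 : ℂ) else 0) := by
    intro S
    calc Uᴴ * dg U S * U = (Uᴴ * U) * diagonal (fun i => if i ∈ S then (1 : ℂ) else 0) * (Uᴴ * U) := by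
          simp only [dg, Matrix.mul_assoc]
      _ = _ := by rw [hU]; simp
  have h1 := key S
  rw [h, key T] at h1
  have h2 := Matrix.diagonal_injective h1
  ext i
  have := congrFun h2 i
  by_cases hS : i ∈ S <;> by_cases hT : i ∈ T <;> simp_all

lemma HP.struct {n r : ℕ} {P : CM n} (hP : HP r P) :
    ∃ U : CM n, Uᴴ * U = 1 ∧ U * Uᴴ = 1 ∧ ∃ S : Finset (Fin n), S.card = r ∧ P = dg U S := by
  obtain ⟨h1, h2, h3⟩ := hP
  obtain ⟨U, hU, hU', d, hd⟩ := spec_aux P h1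
  have hdd : ∀ i, d i * d i = d i := by
    have e : diagonal (fun i => (d i : ℂ)) * diagonal (fun i => (d i : ℂ))
        = diagonal (fun i => (d i : ℂ)) := by
      have key : Uᴴ * P * U = diagonal (fun i => (d i : ℂ)) := by
        calc Uᴴ * P * U = (Uᴴ * U) * diagonal (fun i => (d i : ℂ)) * (Uᴴ * U) := by
              rw [hd]; simp only [Matrix.mul_assoc]
          _ = _ := by rw [hU]; simp
      rw [← key]
      calc Uᴴ * P * U * (Uᴴ * P * U) = Uᴴ * (P * (U * Uᴴ) * P) * U := by simp only [Matrix.mul_assoc]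
        _ = _ := by rw [hU', Matrix.mul_one, h2]
    intro i
    rw [Matrix.diagonal_mul_diagonal] at e
    have := congrFun (Matrix.diagonal_injective e) i
    exact_mod_cast this
  have hd01 : ∀ i, d i = 0 ∨ d i = 1 := by
    intro i
    have : d i * (d i - 1) = 0 := by linear_combination hdd i
    rcases mul_eq_zero.1 this with h | h
    · exact Or.inl h
    · exact Or.inr (by linarith)
  classical
  let S : Finset (Fin n) := Finset.univ.filter (fun i => d i = 1)
  have hPS : P = dg U S := by
    rw [hd, dg]
    congr 3
    ext i
    rcases hd01 i with h | h <;> simp [S, h]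
  refine ⟨U, hU, hU', S, ?_, hPS⟩
  have := (HP_dg hU S).2.2
  rw [← hPS, h3] at this
  exact_mod_cast this.symm

lemma dg_iso {n r : ℕ} {U : CM n} (hU : Uᴴ * U = 1) {S : Finset (Fin n)} (hS : S.card = r) :
    ∃ V : Matrix (Fin n) (Fin r) ℂ, Vᴴ * V = 1 ∧ V * Vᴴ = dg U S ∧
      ∀ i ∈ S, ∃ a : Fin r, V * Matrix.single a a (1 : ℂ) * Vᴴ = U * Matrix.single i i (1 : ℂ) * Uᴴ := by
  let s := S.orderEmbOfFin hS
  have hsinj : Function.Injective s := s.injective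
  let J : Matrix (Fin n) (Fin r) ℂ := Matrix.of fun i a => if i = s a then 1 else 0
  have hJ : Jᴴ * J = 1 := by
    ext a b
    simp [J, Matrix.mul_apply, Matrix.one_apply, hsinj.eq_iff, eq_comm]
  have hJ' : J * Jᴴ = diagonal (fun i => if i ∈ S then (1 : ℂ) else 0) := by
    ext i j
    have hr : ∀ i, i ∈ S ↔ ∃ a, s a = i := by
      intro i
      have := Finset.range_orderEmbOfFin S hS
      rw [← Finset.mem_coe, ← this]; rfl
    simp only [Matrix.mul_apply, J, Matrix.conjTranspose_apply, Matrix.of_apply, Matrix.diagonal_apply]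
    by_cases hi : i ∈ S
    · obtain ⟨a, rfl⟩ := (hr i).1 hi
      rw [Finset.sum_eq_single a]
      · simp [hi, eq_comm]
      · intro b _ hb
        simp [hsinj.eq_iff, hb.symm]
      · simp
    · have : ∀ a, i ≠ s a := fun a h => hi ((hr i).2 ⟨a, h.symm⟩)
      simp [this, hi]
  have hJs : ∀ a, J * Matrix.single a a (1 : ℂ) * Jᴴ = Matrix.single (s a) (s a) (1 : ℂ) := by
    intro a
    ext i j
    rw [Matrix.mul_apply, Finset.sum_eq_single a]
    · rw [Matrix.mul_apply, Finset.sum_eq_single a]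
      · by_cases h1 : i = s a <;> by_cases h2 : j = s a <;>
          simp [J, Matrix.single_apply, h1, h2, eq_comm]
      · intro b _ hb
        simp [Matrix.single_apply, hb.symm]
      · simp
    · intro b _ hb
      rw [Matrix.mul_apply, Finset.sum_eq_zero, zero_mul]
      intro c _
      simp [Matrix.single_apply, hb.symm]
    · simp
  refine ⟨U * J, ?_, ?_, ?_⟩
  · rw [Matrix.conjTranspose_mul]
    calc Jᴴ * Uᴴ * (U * J) = Jᴴ * (Uᴴ * U) * J := by simp only [Matrix.mul_assoc]
      _ = 1 := by rw [hU, Matrix.mul_one, hJ]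
  · rw [Matrix.conjTranspose_mul, dg, ← hJ']
    simp only [Matrix.mul_assoc]
  · intro i hi
    have : i ∈ Set.range s := by
      rw [Finset.range_orderEmbOfFin]; exact hi
    obtain ⟨a, rfl⟩ := this
    refine ⟨a, ?_⟩
    rw [← hJs, Matrix.conjTranspose_mul]
    simp only [Matrix.mul_assoc]

lemma HP.iso {n r : ℕ} {P : CM n} (hP : HP r P) :
    ∃ V : Matrix (Fin n) (Fin r) ℂ, Vᴴ * V = 1 ∧ V * Vᴴ = P := by
  obtain ⟨U, hU, _, S, hS, rfl⟩ := hP.struct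
  obtain ⟨V, h1, h2, _⟩ := dg_iso hU hS
  exact ⟨V, h1, h2⟩

lemma dg_singleton {n : ℕ} (U : CM n) (i : Fin n) :
    dg U {i} = U * Matrix.single i i (1 : ℂ) * Uᴴ := by
  unfold dg
  congr 2
  ext a b
  simp only [Matrix.diagonal_apply, Matrix.single_apply, Finset.mem_singleton]
  by_cases h : a = b
  · subst h; simp [eq_comm]
  · simp only [h, if_false]
    rw [if_neg]
    rintro ⟨rfl, rfl⟩
    exact h rfl

lemma spec_sum {n : ℕ} (U : CM n) (d : Fin n → ℂ) :
    U * diagonal d * Uᴴ = ∑ i, d i • dg U {i} := by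
  have : diagonal d = ∑ i, d i • (diagonal (fun j => if j ∈ ({i} : Finset (Fin n)) then (1 : ℂ) else 0) : CM n) := by
    ext a b
    simp [Matrix.sum_apply, Matrix.diagonal_apply]
    
  rw [this, Matrix.mul_sum, Matrix.sum_mul]
  simp [dg]

lemma dg_sum {n : ℕ} (U : CM n) (S : Finset (Fin n)) : dg U S = ∑ i ∈ S, dg U {i} := by
  rw [dg, spec_sum]
  simp [ite_smul]

lemma span_aux {n k : ℕ} (hk : 1 ≤ k) (hkn : k < n) (M : Submodule ℂ (CM n))
    (hM : ∀ P, HP k P → P ∈ M) : M = ⊤ := by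
  classical
  have h1 : ∀ U : CM n, Uᴴ * U = 1 → ∀ i, dg U {i} ∈ M := by
    intro U hU i
    have hd : ∀ i j, dg U {i} - dg U {j} ∈ M := by
      intro i j
      by_cases hij : i = j
      · subst hij; simp
      obtain ⟨T, hT, hTc⟩ := Finset.exists_subset_card_eq
        (s := (Finset.univ \ {i, j} : Finset (Fin n))) (n := k - 1) (by
          rw [Finset.card_sdiff_of_subset (Finset.subset_univ _), Finset.card_pair hij]
          simp; omega)
      have hiT : i ∉ T := fun h => by simpa using hT h
      have hjT : j ∉ T := fun h => by simpa using hT h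
      have e1 := hM _ ((show ({i} ∪ T).card = k by
        rw [Finset.card_union_of_disjoint (by simpa using hiT)]; simp; omega) ▸ HP_dg hU ({i} ∪ T))
      have e2 := hM _ ((show ({j} ∪ T).card = k by
        rw [Finset.card_union_of_disjoint (by simpa using hjT)]; simp; omega) ▸ HP_dg hU ({j} ∪ T))
      rw [dg_union U (by simpa using hiT)] at e1
      rw [dg_union U (by simpa using hjT)] at e2
      have := M.sub_mem e1 e2
      rwa [add_sub_add_right_eq_sub] at this
    obtain ⟨T, -, hTc⟩ := Finset.exists_subset_card_eq
        (s := (Finset.univ : Finset (Fin n))) (n := k) (by simp; omega)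
    have e1 : dg U T ∈ M := hM _ (hTc ▸ HP_dg hU T)
    have e2 : ∑ j ∈ T, (dg U {i} - dg U {j}) ∈ M := M.sum_mem fun j _ => hd i j
    have e3 := M.add_mem e2 e1
    rw [Finset.sum_sub_distrib, ← dg_sum, sub_add_cancel, Finset.sum_const, hTc,
      ← Nat.cast_smul_eq_nsmul ℂ] at e3
    have hk0 : (k : ℂ) ≠ 0 := by exact_mod_cast (by omega : k ≠ 0)
    exact (M.smul_mem_iff hk0).1 e3
  have h2 : ∀ X : CM n, Xᴴ = X → X ∈ M := by
    intro X hX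
    obtain ⟨U, hU, _, d, rfl⟩ := spec_aux X hX
    rw [spec_sum]
    exact M.sum_mem fun i _ => M.smul_mem _ (h1 U hU i)
  rw [eq_top_iff]
  intro A _
  rw [← realPart_add_I_smul_imaginaryPart A]
  exact M.add_mem (h2 _ (realPart A).2) (M.smul_mem _ (h2 _ (imaginaryPart A).2))

/-! ### Positivity, unitality and orthogonality -/

section PosPart
open scoped ComplexOrder

lemma HP.psd {n r : ℕ} {P : CM n} (hP : HP r P) : P.PosSemidef := by
  have := Matrix.posSemidef_conjTranspose_mul_self P
  rwa [hP.1, hP.2.1] at this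

lemma HP.compl {n r s : ℕ} {P : CM n} (hP : HP r P) (h : r + s = n) : HP s (1 - P) := by
  obtain ⟨h1, h2, h3⟩ := hP
  refine ⟨?_, ?_, ?_⟩
  · simp [h1]
  · rw [mul_sub, sub_mul, sub_mul, h2]; simp
  · rw [Matrix.trace_sub, h3]
    simp [← h]

lemma orth_of_psd {n : ℕ} {Q Q' : CM n} (h1 : Qᴴ = Q) (h2 : Q * Q = Q)
    (h1' : Q'ᴴ = Q') (h2' : Q' * Q' = Q') (h : (1 - Q - Q').PosSemidef) : Q' * Q = 0 := by
  have e1 := h.conjTranspose_mul_mul_same Q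
  have e2 : Qᴴ * (1 - Q - Q') * Q = - ((Q' * Q)ᴴ * (Q' * Q)) := by
    rw [Matrix.conjTranspose_mul, h1, h1']
    have : Q * Q' * (Q' * Q) = Q * Q' * Q := by
      rw [mul_assoc, ← mul_assoc Q' Q', h2', mul_assoc]
    rw [this, mul_sub, sub_mul, mul_sub, sub_mul, h2, mul_one, h2, sub_self, zero_sub]
  rw [e2] at e1
  have t1 := e1.trace_nonneg
  have t2 := (Matrix.posSemidef_conjTranspose_mul_self (Q' * Q)).trace_nonneg
  rw [Matrix.trace_neg] at t1
  have t3 : ((Q' * Q)ᴴ * (Q' * Q)).trace = 0 := le_antisymm (neg_nonneg.1 t1) t2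
  exact Matrix.trace_conjTranspose_mul_self_eq_zero_iff.1 t3

lemma psd_dg {n k : ℕ} (f : CM n →ₗ[ℂ] CM n) (hf : ∀ P, HP k P → HP k (f P))
    {U : CM n} (hU : Uᴴ * U = 1) (m : ℕ) : ∀ S : Finset (Fin n), S.card = m * k →
      (f (dg U S)).PosSemidef ∧ (f (dg U S)).trace = (m * k : ℕ) := by
  classical
  induction m with
  | zero =>
    intro S hS
    have : S = ∅ := by simpa using hS
    subst this
    have : dg U ∅ = 0 := by simp [dg]
    rw [this, map_zero]
    exact ⟨Matrix.PosSemidef.zero, by simp⟩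
  | succ m ih =>
    intro S hS
    obtain ⟨T, hT, hTc⟩ := Finset.exists_subset_card_eq (s := S) (n := k) (by rw [hS]; nlinarith)
    have e : dg U S = dg U T + dg U (S \ T) := by
      rw [← dg_union U Finset.disjoint_sdiff, Finset.union_sdiff_of_subset hT]
    obtain ⟨i1, i2⟩ := ih (S \ T) (by
      rw [Finset.card_sdiff_of_subset hT, hS, hTc, Nat.succ_mul]; omega)
    have hP := hf _ (hTc ▸ HP_dg hU T)
    rw [e, map_add]
    refine ⟨hP.psd.add i1, ?_⟩
    rw [Matrix.trace_add, i2, hP.2.2]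
    push_cast; ring

lemma psd_HP {n k : ℕ} (f : CM n →ₗ[ℂ] CM n) (hf : ∀ P, HP k P → HP k (f P))
    (m : ℕ) {E : CM n} (hE : HP (m * k) E) :
      (f E).PosSemidef ∧ (f E).trace = (m * k : ℕ) := by
  obtain ⟨U, hU, _, S, hS, rfl⟩ := hE.struct
  exact psd_dg f hf hU m S hS

lemma unital {n k q : ℕ} (hk : 1 ≤ k) (hq : 3 ≤ q) (hn : n = q * k) (f : CM n →ₗ[ℂ] CM n)
    (hf : ∀ P, HP k P → HP k (f P)) (hs : ∀ Q, HP k Q → ∃ P, HP k P ∧ f P = Q) : f 1 = 1 := by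
  classical
  have h1 : HP (q * k) (1 : CM n) := ⟨by simp, by simp, by simp [hn]⟩
  obtain ⟨p1, p2⟩ := psd_HP f hf q h1
  have hsub : ∀ Q, HP k Q → (f 1 - Q).PosSemidef := by
    intro Q hQ
    obtain ⟨P, hP, rfl⟩ := hs Q hQ
    rw [← map_sub]
    refine (psd_HP f hf (q - 1) (hP.compl ?_)).1
    obtain ⟨r, rfl⟩ := Nat.exists_eq_add_of_le hq
    rw [hn, show 3 + r - 1 = 2 + r by omega]; ring
  obtain ⟨U, hU, hU', d, hd⟩ := spec_aux (f 1) p1.1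
  have hkn : k ≤ n := by rw [hn]; nlinarith
  have hd1 : ∀ i, 1 ≤ d i := by
    intro i
    obtain ⟨S, hS, -, hSc⟩ := Finset.exists_subsuperset_card_eq (Finset.subset_univ ({i} : Finset (Fin n)))
      (n := k) (by simpa using hk) (by simpa using hkn)
    have hi : i ∈ S := hS (by simp)
    have e1 := (hsub _ (hSc ▸ HP_dg hU S)).conjTranspose_mul_mul_same U
    have e2 : Uᴴ * (f 1 - dg U S) * U = diagonal (fun i => (d i : ℂ))
        - diagonal (fun i => if i ∈ S then (1 : ℂ) else 0) := by
      rw [hd, dg, ← Matrix.sub_mul, ← Matrix.mul_sub]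
      generalize (diagonal (fun i => (d i : ℂ)) - diagonal (fun i => if i ∈ S then (1 : ℂ) else 0) : CM n) = Z
      calc Uᴴ * (U * Z * Uᴴ) * U = (Uᴴ * U) * Z * (Uᴴ * U) := by simp only [Matrix.mul_assoc]
        _ = _ := by rw [hU]; simp
    rw [e2] at e1
    have e3 := e1.diag_nonneg (i := i)
    simp only [Matrix.sub_apply, Matrix.diagonal_apply_eq, hi, if_true] at e3
    have : (1 : ℂ) ≤ d i := sub_nonneg.1 e3
    exact_mod_cast this
  have hsum : ∑ i, (d i - 1) = 0 := by
    have : (f 1).trace = ∑ i, (d i : ℂ) := by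
      rw [hd, sandwich_trace U hU, Matrix.trace_diagonal]
    rw [p2, ← hn] at this
    have e : (n : ℝ) = ∑ i, d i := by exact_mod_cast this
    rw [Finset.sum_sub_distrib, ← e]; simp
  have hall := (Finset.sum_eq_zero_iff_of_nonneg (fun i _ => sub_nonneg.2 (hd1 i))).1 hsum
  have hd' : ∀ i, d i = 1 := fun i => by linarith [hall i (Finset.mem_univ i)]
  rw [hd]
  simp [hd', hU']

lemma orth {n k q : ℕ} (hk : 1 ≤ k) (hq : 3 ≤ q) (hn : n = q * k) (f : CM n →ₗ[ℂ] CM n)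
    (hf : ∀ P, HP k P → HP k (f P)) (hs : ∀ Q, HP k Q → ∃ P, HP k P ∧ f P = Q)
    {P P' : CM n} (hP : HP k P) (hP' : HP k P') (hPP : HP (2 * k) (P + P')) :
    f P * f P' = 0 ∧ f P' * f P = 0 := by
  have h1 := unital hk hq hn f hf hs
  have h2 := (psd_HP f hf (q - 2) (hPP.compl (s := (q - 2) * k) (by
    obtain ⟨r, rfl⟩ := Nat.exists_eq_add_of_le hq
    rw [hn, show 3 + r - 2 = 1 + r by omega]; ring))).1
  rw [map_sub, map_add, h1, ← sub_sub] at h2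
  have h3 := orth_of_psd (hf _ hP).1 (hf _ hP).2.1 (hf _ hP').1 (hf _ hP').2.1 h2
  refine ⟨?_, h3⟩
  have := congrArg Matrix.conjTranspose h3
  rwa [Matrix.conjTranspose_mul, (hf _ hP).1, (hf _ hP').1, Matrix.conjTranspose_zero] at this

/-- If all rank-one projections are sent to projections then `f` is a Jordan map. -/
lemma jordan_of_idem {n : ℕ} (f : CM n →ₗ[ℂ] CM n) (hst : ∀ A, f Aᴴ = (f A)ᴴ) (h1 : f 1 = 1)
    (hf : ∀ P, HP 1 P → f P * f P = f P) (A : CM n) : f (A * A) = f A * f A := by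
  classical
  have hH : ∀ X : CM n, Xᴴ = X → f (X * X) = f X * f X := by
    intro X hX
    obtain ⟨U, hU, hU', d, hd⟩ := spec_aux X hX
    have hp : ∀ i, HP 1 (dg U {i}) := fun i => by simpa using HP_dg hU {i}
    have hQ : ∀ i, (f (dg U {i}))ᴴ = f (dg U {i}) := fun i => by rw [← hst, (hp i).1]
    have hpsd : ∀ i, (f (dg U {i})).PosSemidef := fun i => by
      have := Matrix.posSemidef_conjTranspose_mul_self (f (dg U {i}))
      rwa [hQ, hf _ (hp i)] at this
    have hsum : ∑ i, f (dg U {i}) = 1 := by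
      rw [← map_sum, ← dg_sum, dg_univ hU', h1]
    have ho : ∀ i j, i ≠ j → f (dg U {i}) * f (dg U {j}) = 0 := by
      intro i j hij
      apply orth_of_psd (hQ j) (hf _ (hp j)) (hQ i) (hf _ (hp i))
      have : (1 : CM n) - f (dg U {j}) - f (dg U {i})
          = ∑ l ∈ (Finset.univ.erase j).erase i, f (dg U {l}) := by
        rw [← hsum, ← Finset.add_sum_erase _ _ (Finset.mem_univ j),
          ← Finset.add_sum_erase (Finset.univ.erase j) _ (show i ∈ Finset.univ.erase j by simp [hij])]
        abel
      rw [this]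
      exact Matrix.posSemidef_sum _ fun l _ => hpsd l
    have hXX : X * X = ∑ i, ((d i : ℂ) * d i) • dg U {i} := by
      rw [← spec_sum, hd, sandwich U hU, Matrix.diagonal_mul_diagonal]
    have hX' : X = ∑ i, (d i : ℂ) • dg U {i} := by rw [← spec_sum, ← hd]
    rw [hXX]
    conv_rhs => rw [hX']
    simp only [map_sum, map_smul, Finset.sum_mul, Finset.mul_sum]
    refine Finset.sum_congr rfl fun i _ => ?_
    rw [Finset.sum_eq_single i]
    · rw [smul_mul_smul_comm, hf _ (hp i)]
    · intro j _ hj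
      rw [smul_mul_smul_comm, ho j i hj, smul_zero]
    · simp
  have hpol : ∀ X Y : CM n, Xᴴ = X → Yᴴ = Y → f (X * Y + Y * X) = f X * f Y + f Y * f X := by
    intro X Y hX hY
    have := hH (X + Y) (by simp [hX, hY])
    have e : (X + Y) * (X + Y) = X * X + Y * Y + (X * Y + Y * X) := by noncomm_ring
    have e' : (f X + f Y) * (f X + f Y) = f X * f X + f Y * f Y + (f X * f Y + f Y * f X) := by
      noncomm_ring
    rw [e, map_add, map_add f (X * X), map_add f X Y, hH X hX, hH Y hY, e'] at this
    exact add_left_cancel this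
  obtain ⟨X, Y, hX, hY, rfl⟩ : ∃ X Y : CM n, Xᴴ = X ∧ Yᴴ = Y ∧ A = X + Complex.I • Y :=
    ⟨realPart A, imaginaryPart A, (realPart A).2, (imaginaryPart A).2,
      (realPart_add_I_smul_imaginaryPart A).symm⟩
  have expand : ∀ X Y : CM n, (X + Complex.I • Y) * (X + Complex.I • Y)
      = X * X - Y * Y + Complex.I • (X * Y + Y * X) := by
    intro X Y
    rw [add_mul, mul_add, mul_add, smul_mul_smul_comm, Complex.I_mul_I, mul_smul_comm, smul_mul_assoc,
      smul_add, neg_one_smul]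
    abel
  rw [expand, map_add, map_sub, map_smul, hpol X Y hX hY, hH X hX, hH Y hY, map_add, map_smul, expand]

end PosPart

/-! ### Restriction to corners of size `2k` -/

lemma mem_projSet {n k : ℕ} (P : BH n) : P ∈ projSet n k ↔ HP k (P : CM n) := by
  constructor
  · rintro ⟨h1, h2⟩
    refine ⟨P.2, h1, ?_⟩
    rw [rank_trace _ h1, h2]
  · rintro ⟨_, h1, h2⟩
    refine ⟨h1, ?_⟩
    rw [rank_trace _ h1] at h2
    exact_mod_cast h2

lemma wig_idem {n : ℕ} {Ψ : BH n →ₗ[ℝ] BH n} (h : WignerForm n Ψ) (X : BH n)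
    (hX : (X : CM n) * X = X) : (Ψ X : CM n) * Ψ X = Ψ X := by
  obtain ⟨U, hU, h⟩ := h
  have hU' : Uᴴ * U = 1 := Matrix.mem_unitaryGroup_iff'.1 hU
  rcases h with h | h
  · rw [h, sandwich U hU', hX]
  · rw [h, sandwich U hU', ← Matrix.transpose_mul, hX]

lemma wig_one {n : ℕ} {Ψ : BH n →ₗ[ℝ] BH n} (h : WignerForm n Ψ) :
    (Ψ 1 : CM n) = 1 := by
  obtain ⟨U, hU, h⟩ := h
  have hU' : U * Uᴴ = 1 := Matrix.mem_unitaryGroup_iff.1 hU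
  rcases h with h | h
  · rw [h]; simp [hU']
  · rw [h]; simp [hU']

lemma corner {n k q : ℕ} (hk : 1 ≤ k) (hq : 3 ≤ q) (hn : n = q * k)
    (conjecture1 : ∀ Ψ : BH (2 * k) →ₗ[ℝ] BH (2 * k),
      (⇑Ψ) '' projSet (2 * k) k = projSet (2 * k) k →
      WignerForm (2 * k) Ψ ∨
        ∃ Ψ' : BH (2 * k) →ₗ[ℝ] BH (2 * k),
          WignerForm (2 * k) Ψ' ∧ Ψ = Ψ'.comp (Rmap (2 * k) k))
    (f : CM n →ₗ[ℂ] CM n) (hst : ∀ A, f Aᴴ = (f A)ᴴ) (hinj : Function.Injective f)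
    (hf : ∀ P, HP k P → HP k (f P)) (hs : ∀ Q, HP k Q → ∃ P, HP k P ∧ f P = Q)
    (V : Matrix (Fin n) (Fin (2 * k)) ℂ) (hV : Vᴴ * V = 1)
    (p : CM (2 * k)) (hp : HP 1 p) :
    f (V * p * Vᴴ) * f (V * p * Vᴴ) = f (V * p * Vᴴ) ∨
    ∃ ρ F : CM n, F = f (V * Vᴴ) ∧ F * F = F ∧ ρ * ρ = ρ ∧ F * ρ = ρ ∧ ρ * F = ρ ∧
      f (V * p * Vᴴ) = (k : ℂ)⁻¹ • F - ρ := by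
  classical
  have hone : HP (2 * k) (1 : CM (2 * k)) := ⟨by simp, by simp, by simp⟩
  have hE : HP (2 * k) (V * Vᴴ) := by simpa using hone.sandwich hV
  -- complementary pairs
  have hpair : ∀ P : CM (2 * k), HP k P → V * P * Vᴴ + V * (1 - P) * Vᴴ = V * Vᴴ := by
    intro P _
    rw [← Matrix.add_mul, ← Matrix.mul_add]; simp
  set F := f (V * Vᴴ) with hFdef
  have hcor : ∀ P : CM (2 * k), HP k P → HP (2 * k) F ∧ F * f (V * P * Vᴴ) = f (V * P * Vᴴ) ∧
      f (V * P * Vᴴ) * F = f (V * P * Vᴴ) := by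
    intro P hP
    have hP' : HP k (1 - P) := hP.compl (by omega)
    have hQ := hf _ (hP.sandwich hV)
    have hQ' := hf _ (hP'.sandwich hV)
    have hsum := hpair P hP
    obtain ⟨o1, o2⟩ := orth hk hq hn f hf hs (hP.sandwich hV) (hP'.sandwich hV) (by rw [hsum]; exact hE)
    have hF : F = f (V * P * Vᴴ) + f (V * (1 - P) * Vᴴ) := by rw [← map_add, hsum]
    rw [hF]
    generalize f (V * P * Vᴴ) = Q at *
    generalize f (V * (1 - P) * Vᴴ) = Q' at *
    refine ⟨⟨?_, ?_, ?_⟩, ?_, ?_⟩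
    · rw [Matrix.conjTranspose_add, hQ.1, hQ'.1]
    · rw [add_mul, mul_add, mul_add, o1, o2, hQ.2.1, hQ'.2.1]; simp
    · rw [Matrix.trace_add, hQ.2.2, hQ'.2.2]; push_cast; ring
    · rw [add_mul, o2, hQ.2.1, add_zero]
    · rw [mul_add, o1, hQ.2.1, add_zero]
  have hF : HP (2 * k) F := by
    obtain ⟨T, -, hTc⟩ := Finset.exists_subset_card_eq
        (s := (Finset.univ : Finset (Fin (2 * k)))) (n := k) (by simp; omega)
    exact (hcor _ (hTc ▸ HP_dg (U := (1 : CM (2 * k))) (by simp) T)).1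
  obtain ⟨W, hW, hWF⟩ := hF.iso
  have hWred : ∀ X : CM (2 * k), W * (Wᴴ * f (V * X * Vᴴ) * W) * Wᴴ = f (V * X * Vᴴ) := by
    let g1 : CM (2 * k) →ₗ[ℂ] CM n :=
      { toFun := fun X => W * (Wᴴ * f (V * X * Vᴴ) * W) * Wᴴ
        map_add' := fun X Y => by simp [Matrix.mul_add, Matrix.add_mul]
        map_smul' := fun c X => by simp }
    let g2 : CM (2 * k) →ₗ[ℂ] CM n :=
      { toFun := fun X => f (V * X * Vᴴ)
        map_add' := fun X Y => by simp [Matrix.mul_add, Matrix.add_mul]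
        map_smul' := fun c X => by simp }
    have htop := span_aux hk (by omega : k < 2 * k) (LinearMap.eqLocus g1 g2) (by
      intro P hP
      show W * (Wᴴ * f (V * P * Vᴴ) * W) * Wᴴ = f (V * P * Vᴴ)
      calc W * (Wᴴ * f (V * P * Vᴴ) * W) * Wᴴ = (W * Wᴴ) * f (V * P * Vᴴ) * (W * Wᴴ) := by
            simp only [Matrix.mul_assoc]
        _ = _ := by rw [hWF, (hcor P hP).2.1, (hcor P hP).2.2])
    intro X
    have : X ∈ LinearMap.eqLocus g1 g2 := by rw [htop]; trivial
    exact this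
  let Ψ : BH (2 * k) →ₗ[ℝ] BH (2 * k) :=
    { toFun := fun X => ⟨Wᴴ * f (V * (X : CM (2 * k)) * Vᴴ) * W, by
        rw [selfAdjoint.mem_iff, Matrix.star_eq_conjTranspose]
        have hX : (X : CM (2 * k))ᴴ = X := X.2
        rw [Matrix.conjTranspose_mul, Matrix.conjTranspose_mul, ← hst, sandwich_star, hX]
        simp [Matrix.mul_assoc]⟩
      map_add' := fun X Y => Subtype.ext (by simp [Matrix.mul_add, Matrix.add_mul])
      map_smul' := fun c X => Subtype.ext (by
        have : f (c • (V * (X : CM (2 * k)) * Vᴴ)) = c • f (V * (X : CM (2 * k)) * Vᴴ) :=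
          LinearMap.map_smul_of_tower f c _
        simp [this]) }
  have hΨ : ∀ X : BH (2 * k), (Ψ X : CM (2 * k)) = Wᴴ * f (V * (X : CM (2 * k)) * Vᴴ) * W := fun _ => rfl
  have compress : ∀ {r : ℕ} (W : Matrix (Fin n) (Fin (2 * k)) ℂ) (F Q : CM n), W * Wᴴ = F →
      HP r Q → F * Q = Q → Q * F = Q → HP r (Wᴴ * Q * W) := by
    intro r W F Q hWF hQ h1 h2
    refine ⟨?_, ?_, ?_⟩
    · rw [Matrix.conjTranspose_mul, Matrix.conjTranspose_mul, hQ.1]; simp [Matrix.mul_assoc]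
    · calc Wᴴ * Q * W * (Wᴴ * Q * W) = Wᴴ * (Q * (W * Wᴴ) * Q) * W := by simp only [Matrix.mul_assoc]
        _ = _ := by rw [hWF, h2, hQ.2.1]
    · rw [Matrix.trace_mul_comm, ← Matrix.mul_assoc, hWF, h1, hQ.2.2]
  have himg : (⇑Ψ) '' projSet (2 * k) k = projSet (2 * k) k := by
    apply Set.Subset.antisymm
    · rintro _ ⟨X, hX, rfl⟩
      rw [mem_projSet] at hX ⊢
      rw [hΨ]
      exact compress W F _ hWF (hf _ (hX.sandwich hV)) (hcor _ hX).2.1 (hcor _ hX).2.2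
    · intro P hP
      rw [mem_projSet] at hP
      have hP' : HP k (1 - (P : CM (2 * k))) := hP.compl (by omega)
      obtain ⟨R, hR, hRQ⟩ := hs _ (hP.sandwich hW)
      obtain ⟨R', hR', hRQ'⟩ := hs _ (hP'.sandwich hW)
      have hRR : R + R' = V * Vᴴ := by
        apply hinj
        rw [map_add, hRQ, hRQ', ← Matrix.add_mul, ← Matrix.mul_add, ← hFdef, ← hWF]
        simp
      have hcomm : R * R' + R' * R = 0 := by
        have := hE.2.1
        rw [← hRR, add_mul, mul_add, mul_add, hR.2.1, hR'.2.1] at this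
        have e : R * R' + R' * R = (R + R * R' + (R' * R + R')) - (R + R') := by abel
        rw [e, this, sub_self]
      have o1 : R * R' = - (R * R' * R) := by
        have := congrArg (fun Z => R * Z) hcomm
        simp only [mul_add, mul_zero, ← mul_assoc, hR.2.1] at this
        exact eq_neg_of_add_eq_zero_left this
      have o2 : R' * R = - (R * R' * R) := by
        have := congrArg (fun Z => Z * R) hcomm
        simp only [add_mul, zero_mul, mul_assoc, hR.2.1] at this
        rw [mul_assoc]
        exact eq_neg_of_add_eq_zero_right this
      have o3 : R * R' = 0 := by
        rw [o2, ← o1, ← two_smul ℂ] at hcomm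
        exact (smul_eq_zero.1 hcomm).resolve_left two_ne_zero
      have o4 : R' * R = 0 := by rw [o2, ← o1, o3]
      have c1 : V * Vᴴ * R = R := by rw [← hRR, add_mul, o4, hR.2.1, add_zero]
      have c2 : R * (V * Vᴴ) = R := by rw [← hRR, mul_add, o3, hR.2.1, add_zero]
      have hX := compress V _ R rfl hR c1 c2
      refine ⟨⟨Vᴴ * R * V, hX.1⟩, (mem_projSet _).2 hX, Subtype.ext ?_⟩
      rw [hΨ]
      have e : V * (Vᴴ * R * V) * Vᴴ = R := by
        calc V * (Vᴴ * R * V) * Vᴴ = (V * Vᴴ * R) * (V * Vᴴ) := by simp only [Matrix.mul_assoc]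
          _ = R := by rw [c1, c2]
      show Wᴴ * f (V * (Vᴴ * R * V) * Vᴴ) * W = P
      rw [e, hRQ]
      calc Wᴴ * (W * (P : CM (2 * k)) * Wᴴ) * W = (Wᴴ * W) * (P : CM (2 * k)) * (Wᴴ * W) := by
            simp only [Matrix.mul_assoc]
        _ = _ := by rw [hW]; simp
  let pp : BH (2 * k) := ⟨p, hp.1⟩
  have hpp : (pp : CM (2 * k)) * pp = pp := hp.2.1
  have hfp : f (V * p * Vᴴ) = W * (Ψ pp : CM (2 * k)) * Wᴴ := (hWred p).symm
  rcases conjecture1 Ψ himg with hw | ⟨Ψ', hw, hcomp⟩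
  · left
    rw [hfp, sandwich W hW, wig_idem hw pp hpp]
  · right
    have hR : Rmap (2 * k) k pp = (k : ℝ)⁻¹ • (1 : BH (2 * k)) - pp := by
      apply Subtype.ext
      show (k : ℂ)⁻¹ • p.trace • (1 : CM (2 * k)) - p = (k : ℝ)⁻¹ • (1 : CM (2 * k)) - p
      rw [hp.2.2, Nat.cast_one, one_smul]
      congr 1
      ext i j
      simp
    have hΨp : (Ψ pp : CM (2 * k)) = (k : ℂ)⁻¹ • 1 - (Ψ' pp : CM (2 * k)) := by
      rw [hcomp, LinearMap.comp_apply, hR, map_sub, map_smul]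
      show (k : ℝ)⁻¹ • (Ψ' 1 : CM (2 * k)) - _ = _
      rw [wig_one hw]
      congr 1
      ext i j
      simp
    refine ⟨W * (Ψ' pp : CM (2 * k)) * Wᴴ, F, rfl, hF.2.1, ?_, ?_, ?_, ?_⟩
    · rw [sandwich W hW, wig_idem hw pp hpp]
    · have := sandwich W hW 1 (Ψ' pp : CM (2 * k))
      rwa [Matrix.mul_one, hWF, Matrix.one_mul] at this
    · have := sandwich W hW (Ψ' pp : CM (2 * k)) 1
      rwa [Matrix.mul_one, hWF, Matrix.mul_one] at this
    · rw [hfp, hΨp, Matrix.mul_sub, Matrix.sub_mul, Matrix.mul_smul, Matrix.smul_mul, Matrix.mul_one, hWF]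

lemma idem_rank_one {n k q : ℕ} (hk : 1 ≤ k) (hq : 3 ≤ q) (hn : n = q * k)
    (conjecture1 : ∀ Ψ : BH (2 * k) →ₗ[ℝ] BH (2 * k),
      (⇑Ψ) '' projSet (2 * k) k = projSet (2 * k) k →
      WignerForm (2 * k) Ψ ∨
        ∃ Ψ' : BH (2 * k) →ₗ[ℝ] BH (2 * k),
          WignerForm (2 * k) Ψ' ∧ Ψ = Ψ'.comp (Rmap (2 * k) k))
    (f : CM n →ₗ[ℂ] CM n) (hst : ∀ A, f Aᴴ = (f A)ᴴ) (hinj : Function.Injective f)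
    (hf : ∀ P, HP k P → HP k (f P)) (hs : ∀ Q, HP k Q → ∃ P, HP k P ∧ f P = Q)
    (P : CM n) (hP : HP 1 P) : f P * f P = f P := by
  classical
  by_contra hcon
  obtain ⟨U, hU, hU', T, hT, rfl⟩ := hP.struct
  obtain ⟨i, rfl⟩ := Finset.card_eq_one.1 hT
  have key : ∀ S : Finset (Fin n), S.card = 2 * k → i ∈ S →
      ∃ ρ F : CM n, F = f (dg U S) ∧ F * F = F ∧ ρ * ρ = ρ ∧ F * ρ = ρ ∧ ρ * F = ρ ∧
      f (dg U {i}) = (k : ℂ)⁻¹ • F - ρ := by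
    intro S hS hi
    obtain ⟨V, hV, hVS, h⟩ := dg_iso hU hS
    obtain ⟨a, ha⟩ := h i hi
    have hp : HP 1 (Matrix.single a a (1 : ℂ) : CM (2 * k)) := by
      have := HP_dg (U := (1 : CM (2 * k))) (by simp) {a}
      rw [dg_singleton] at this
      simpa using this
    have := corner hk hq hn conjecture1 f hst hinj hf hs V hV _ hp
    rw [ha, ← dg_singleton, hVS] at this
    exact this.resolve_left hcon
  have key2 : ∀ S : Finset (Fin n), S.card = 2 * k → i ∈ S →
      ((k : ℂ)⁻¹ - (k : ℂ)⁻¹ * (k : ℂ)⁻¹) • f (dg U S)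
        = f (dg U {i}) * f (dg U {i}) + (1 - 2 * (k : ℂ)⁻¹) • f (dg U {i}) := by
    intro S hS hi
    obtain ⟨ρ, F, hF, h1, h2, h3, h4, h5⟩ := key S hS hi
    rw [← hF, h5]
    generalize (k : ℂ)⁻¹ = c
    rw [sub_mul, mul_sub, mul_sub, smul_mul_smul_comm, h1, smul_mul_assoc, mul_smul_comm, h2, h3, h4]
    module
  have h2k : 2 * k < n := by
    rw [hn]; nlinarith
  obtain ⟨S, hS, -, hSc⟩ := Finset.exists_subsuperset_card_eq (Finset.subset_univ ({i} : Finset (Fin n)))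
      (n := 2 * k) (by simp; omega) (by simp; omega)
  have hi : i ∈ S := hS (by simp)
  obtain ⟨j, hj⟩ : ∃ j, j ∉ S := by
    by_contra h
    push Not at h
    have : S = Finset.univ := Finset.eq_univ_iff_forall.2 h
    rw [this] at hSc
    simp at hSc
    omega
  obtain ⟨l, hl⟩ : (S.erase i).Nonempty := by
    rw [← Finset.card_pos, Finset.card_erase_of_mem hi]; omega
  obtain ⟨hli, hlS⟩ := Finset.mem_erase.1 hl
  have hS'c : (insert j (S.erase l)).card = 2 * k := by
    rw [Finset.card_insert_of_notMem (fun h => hj (Finset.mem_of_mem_erase h)),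
      Finset.card_erase_of_mem hlS]; omega
  have hiS' : i ∈ insert j (S.erase l) := by
    simp [hi, hli.symm]
  have e := (key2 S hSc hi).trans (key2 _ hS'c hiS').symm
  by_cases hc : (k : ℂ)⁻¹ - (k : ℂ)⁻¹ * (k : ℂ)⁻¹ = 0
  · have hk0 : (k : ℂ)⁻¹ ≠ 0 := inv_ne_zero (by exact_mod_cast (by omega : k ≠ 0))
    have hc1 : (k : ℂ)⁻¹ = 1 := by
      have : (k : ℂ)⁻¹ * (1 - (k : ℂ)⁻¹) = 0 := by linear_combination hc
      have := (mul_eq_zero.1 this).resolve_left hk0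
      linear_combination -this
    have := key2 S hSc hi
    rw [hc1] at this
    apply hcon
    have e : (1 : ℂ) - 2 * 1 = -1 := by norm_num
    rw [e] at this
    simp only [mul_one, sub_self, zero_smul, neg_smul, one_smul] at this
    exact eq_of_sub_eq_zero (by rw [sub_eq_add_neg]; exact this.symm)
  · have h1 := hinj (smul_right_injective _ hc e)
    have h2 := dg_inj hU h1
    apply hj
    rw [h2]
    simp

/-! ### Complexification -/

/-- The complex-linear extension of a real-linear map on Hermitian matrices. -/
def cx {n : ℕ} (Φ : BH n →ₗ[ℝ] BH n) : CM n →ₗ[ℂ] CM n where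
  toFun A := (Φ (realPart A) : CM n) + Complex.I • (Φ (imaginaryPart A) : CM n)
  map_add' A B := by
    simp only [map_add, AddSubgroup.coe_add, smul_add]
    abel
  map_smul' z A := by
    have hs : ∀ (r : ℝ) (X : BH n), ((r • X : BH n) : CM n) = (r : ℂ) • (X : CM n) := by
      intro r X
      ext i j
      simp
    simp only [realPart_smul, imaginaryPart_smul, map_add, map_sub, map_smul, AddSubgroup.coe_add,
      AddSubgroup.coe_sub, hs, RingHom.id_apply]
    generalize (Φ (realPart A) : CM n) = X
    generalize (Φ (imaginaryPart A) : CM n) = Y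
    have hz : z = z.re + z.im * Complex.I := (Complex.re_add_im z).symm
    have hz2 : z * Complex.I = z.re * Complex.I - z.im := by
      conv_lhs => rw [hz]
      linear_combination (z.im : ℂ) * Complex.I_mul_I
    have hzX : z • X = ((z.re : ℂ) + z.im * Complex.I) • X := by rw [← hz]
    rw [smul_add z, smul_smul z, hz2, hzX]
    module

lemma cx_coe {n : ℕ} (Φ : BH n →ₗ[ℝ] BH n) (X : BH n) : cx Φ (X : CM n) = Φ X := by
  show (Φ (realPart (X : CM n)) : CM n) + Complex.I • (Φ (imaginaryPart (X : CM n)) : CM n) = _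
  rw [selfAdjoint.realPart_coe, selfAdjoint.imaginaryPart_coe]
  simp

lemma cx_star {n : ℕ} (Φ : BH n →ₗ[ℝ] BH n) (A : CM n) : cx Φ Aᴴ = (cx Φ A)ᴴ := by
  have h1 : (cx Φ A) = (Φ (realPart A) : CM n) + Complex.I • (Φ (imaginaryPart A) : CM n) := rfl
  have hA : Aᴴ = (realPart A : CM n) - Complex.I • (imaginaryPart A : CM n) := by
    conv_lhs => rw [← realPart_add_I_smul_imaginaryPart A]
    rw [Matrix.conjTranspose_add, Matrix.conjTranspose_smul,
      show (realPart A : CM n)ᴴ = realPart A from (realPart A).2,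
      show (imaginaryPart A : CM n)ᴴ = imaginaryPart A from (imaginaryPart A).2]
    simp [sub_eq_add_neg]
  rw [h1, hA, map_sub, map_smul, cx_coe, cx_coe, Matrix.conjTranspose_add, Matrix.conjTranspose_smul,
      show (Φ (realPart A) : CM n)ᴴ = Φ (realPart A) from (Φ (realPart A)).2,
      show (Φ (imaginaryPart A) : CM n)ᴴ = Φ (imaginaryPart A) from (Φ (imaginaryPart A)).2]
  simp [sub_eq_add_neg]


theorem stmt_8 (k q : ℕ) (hk : 1 ≤ k) (hq : 3 ≤ q)
    (conjecture1 : ∀ Ψ : BH (2 * k) →ₗ[ℝ] BH (2 * k),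
      (⇑Ψ) '' projSet (2 * k) k = projSet (2 * k) k →
      WignerForm (2 * k) Ψ ∨
        ∃ Ψ' : BH (2 * k) →ₗ[ℝ] BH (2 * k),
          WignerForm (2 * k) Ψ' ∧ Ψ = Ψ'.comp (Rmap (2 * k) k))
    (Φ : BH (q * k) →ₗ[ℝ] BH (q * k))
    (hΦ : (⇑Φ) '' projSet (q * k) k = projSet (q * k) k) :
    WignerForm (q * k) Φ := by
  have hf : ∀ P, HP k P → HP k (cx Φ P) := by
    intro P hP
    have : Φ ⟨P, hP.1⟩ ∈ projSet (q * k) k := by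
      rw [← hΦ]
      exact ⟨_, (mem_projSet _).2 hP, rfl⟩
    rw [mem_projSet, ← cx_coe] at this
    exact this
  have hs : ∀ Q, HP k Q → ∃ P, HP k P ∧ cx Φ P = Q := by
    intro Q hQ
    have : (⟨Q, hQ.1⟩ : BH (q * k)) ∈ projSet (q * k) k := (mem_projSet _).2 hQ
    rw [← hΦ] at this
    obtain ⟨P, hP, hPQ⟩ := this
    refine ⟨P, (mem_projSet _).1 hP, ?_⟩
    rw [cx_coe, hPQ]
  have hsurj : Function.Surjective (cx Φ) := by
    rw [← LinearMap.range_eq_top]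
    refine span_aux hk (by nlinarith) _ ?_
    intro Q hQ
    obtain ⟨P, -, h⟩ := hs Q hQ
    exact ⟨P, h⟩
  have hinj : Function.Injective (cx Φ) := LinearMap.injective_iff_surjective.2 hsurj
  have hJ := jordan_of_idem (cx Φ) (cx_star Φ) (unital hk hq rfl _ hf hs)
    (idem_rank_one hk hq rfl conjecture1 (cx Φ) (cx_star Φ) hinj hf hs)
  obtain ⟨U, hU, h⟩ := wigner_aux (cx Φ) ⟨hinj, hsurj⟩ hJ (cx_star Φ)
  refine ⟨U, hU, ?_⟩
  rcases h with h | h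
  · exact Or.inl fun X => by rw [← cx_coe, h]
  · exact Or.inr fun X => by rw [← cx_coe, h]
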